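/- Let φ : sl(2,ℝ) → sl(2,ℝ) be an ℝ-linear map that is self-adjoint with respect to the Killing form κ, i.e. κ(φ(x), y) = κ(x, φ(y)) for all x, y, and that commutes with ad(e), where e = E₁₂ is the elementary matrix with 1 in position (1,2) and 0 elsewhere. Then φ has an eigenvalue whose eigenspace has dimension at least 2. -/

import Mathlib

open Matrix Module LieAlgebra LieAlgebra.SpecialLinear

/-- The standard nilpotent element e = E₁₂ of sl(2,ℝ). -/
noncomputable def E : sl (Fin 2) ℝ :=
  ⟨!![0, 1; 0, 0], show _ ∈ LinearMap.ker (traceLinearMap (Fin 2) ℝ ℝ) by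
    simp [LinearMap.mem_ker, Matrix.trace_fin_two, Matrix.vecHead, Matrix.vecTail]⟩

/-- The diagonal element h = E₁₁ - E₂₂ of sl(2,ℝ). -/
noncomputable def H : sl (Fin 2) ℝ := singleSubSingle 0 1 1

/-- The lower triangular element f = E₂₁ of sl(2,ℝ). -/
noncomputable def F : sl (Fin 2) ℝ := single 1 0 one_ne_zero 1

@[simp] theorem coe_E : (E : Matrix (Fin 2) (Fin 2) ℝ) = !![0, 1; 0, 0] := rfl

@[simp] theorem coe_H : (H : Matrix (Fin 2) (Fin 2) ℝ) = !![1, 0; 0, -1] := by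
  ext i j; fin_cases i <;> fin_cases j <;> simp [H]

@[simp] theorem coe_F : (F : Matrix (Fin 2) (Fin 2) ℝ) = !![0, 0; 1, 0] := by
  ext i j; fin_cases i <;> fin_cases j <;> simp [F]

theorem lie_E_F : ⁅E, F⁆ = H := by
  ext i j; fin_cases i <;> fin_cases j <;> simp [Ring.lie_def]

theorem lie_H_E : ⁅H, E⁆ = (2 : ℝ) • E := by
  ext i j; fin_cases i <;> fin_cases j <;> norm_num [Ring.lie_def]

theorem lie_H_F : ⁅H, F⁆ = (-2 : ℝ) • F := by
  ext i j; fin_cases i <;> fin_cases j <;> norm_num [Ring.lie_def]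

theorem lie_E_H : ⁅E, H⁆ = (-2 : ℝ) • E := by
  rw [← lie_skew, lie_H_E, neg_smul]

theorem sl_two_apply_one_one (x : sl (Fin 2) ℝ) : x.val 1 1 = -x.val 0 0 := by
  have h : Matrix.trace x.val = 0 := x.property
  rw [Matrix.trace_fin_two] at h
  linarith

theorem sl_two_eq_combination (x : sl (Fin 2) ℝ) :
    x = x.val 0 1 • E + x.val 0 0 • H + x.val 1 0 • F := by
  ext i j; fin_cases i <;> fin_cases j <;> simp [sl_two_apply_one_one]

/-- The basis (e, h, f) of sl(2,ℝ). -/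
noncomputable def slTwoBasis : Basis (Fin 3) ℝ (sl (Fin 2) ℝ) :=
  Basis.ofEquivFun
    { toFun := fun x ↦ ![x.val 0 1, x.val 0 0, x.val 1 0]
      invFun := fun v ↦ v 0 • E + v 1 • H + v 2 • F
      map_add' := fun x y ↦ by ext i; fin_cases i <;> simp
      map_smul' := fun c x ↦ by ext i; fin_cases i <;> simp
      left_inv := fun x ↦ by simpa using (sl_two_eq_combination x).symm
      right_inv := fun v ↦ by ext i; fin_cases i <;> simp }

theorem coe_slTwoBasis : ⇑slTwoBasis = ![E, H, F] := by
  funext i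
  rw [slTwoBasis, Basis.coe_ofEquivFun]
  fin_cases i <;> simp

theorem killingForm_H_H : killingForm ℝ (sl (Fin 2) ℝ) H H = 8 := by
  have hE : slTwoBasis 0 = E := by simp [coe_slTwoBasis]
  have hH : slTwoBasis 1 = H := by simp [coe_slTwoBasis]
  have hF : slTwoBasis 2 = F := by simp [coe_slTwoBasis]
  rw [killingForm_apply_apply, LinearMap.trace_eq_matrix_trace ℝ slTwoBasis,
    Matrix.trace_fin_three]
  simp only [LinearMap.toMatrix_apply, LinearMap.comp_apply, LieAlgebra.ad_apply, hE, hH, hF,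
    lie_H_E, lie_H_F, lie_self, lie_smul, lie_zero]
  simp only [← hE, ← hF, map_smul, map_zero, Basis.repr_self]
  simp
  norm_num

theorem killingForm_F_H : killingForm ℝ (sl (Fin 2) ℝ) F H = 0 := by
  have h := LieModule.traceForm_apply_lie_apply ℝ (sl (Fin 2) ℝ) (sl (Fin 2) ℝ) F H H
  rw [← lie_skew, lie_H_F] at h
  simpa using h

theorem killingForm_E_H : killingForm ℝ (sl (Fin 2) ℝ) E H = 0 := by
  have h := LieModule.traceForm_apply_lie_apply ℝ (sl (Fin 2) ℝ) (sl (Fin 2) ℝ) E H H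
  rw [lie_E_H] at h
  simpa using h

theorem killingForm_F_E : killingForm ℝ (sl (Fin 2) ℝ) F E = 4 := by
  have h := LieModule.traceForm_apply_lie_apply ℝ (sl (Fin 2) ℝ) (sl (Fin 2) ℝ) F E H
  rw [← lie_skew, lie_E_F, lie_E_H] at h
  have h8 := killingForm_H_H
  simp only [map_neg, map_smul, LinearMap.neg_apply, smul_eq_mul] at h
  linarith

/-- A linear endomorphism of sl(2,ℝ) which is self-adjoint for the Killing form and
commutes with ad(e), e = E₁₂, has an eigenvalue whose eigenspace has dimension at
least 2. -/
theorem selfadjoint_commuting_with_ad_unipotent_has_big_eigenspace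
    (φ : sl (Fin 2) ℝ →ₗ[ℝ] sl (Fin 2) ℝ)
    (hsa : ∀ x y : sl (Fin 2) ℝ,
      killingForm ℝ (sl (Fin 2) ℝ) (φ x) y = killingForm ℝ (sl (Fin 2) ℝ) x (φ y))
    (hcomm : ∀ x : sl (Fin 2) ℝ, φ ⁅E, x⁆ = ⁅E, φ x⁆) :
    ∃ c : ℝ, 2 ≤ finrank ℝ (Module.End.eigenspace φ c) := by
  obtain ⟨c, b, a, hF⟩ : ∃ c b a : ℝ, φ F = c • E + b • H + a • F :=
    ⟨_, _, _, sl_two_eq_combination (φ F)⟩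
  have hH : φ H = (-2 * b) • E + a • H := by
    rw [← lie_E_F, hcomm, hF]
    simp only [lie_add, lie_smul, lie_self, lie_E_H, lie_E_F]
    module
  have hE : φ E = a • E := by
    have h := hcomm H
    rw [lie_E_H, hH] at h
    simp only [map_smul, lie_add, lie_smul, lie_self, lie_E_H] at h
    linear_combination (norm := module) (-1 / 2 : ℝ) • h
  have hb : b = 0 := by
    have h := hsa F H
    rw [hF, hH] at h
    simp only [map_add, map_smul, LinearMap.add_apply, LinearMap.smul_apply, smul_eq_mul,
      killingForm_H_H, killingForm_F_H, killingForm_E_H, killingForm_F_E] at h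
    linarith
  have hli : LinearIndependent ℝ ![E, H] := by
    rw [LinearIndependent.pair_iff]
    intro s t h
    have hval := congrArg Subtype.val h
    exact ⟨by simpa using congrFun₂ hval 0 1, by simpa using congrFun₂ hval 0 0⟩
  have := slTwoBasis.finiteDimensional_of_finite
  refine ⟨a, ?_⟩
  have hle : Submodule.span ℝ (Set.range ![E, H]) ≤ Module.End.eigenspace φ a := by
    rw [Submodule.span_le]
    rintro _ ⟨i, rfl⟩
    fin_cases i <;> simp [hE, hH, hb]
  simpa [finrank_span_eq_card hli] using Submodule.finrank_mono hle
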